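/- arXiv:2106.05480 — 2 statements merged into one kernel-verified Lean document; each statement's English description precedes it below -/
import Mathlib

section
/- Fix h ∈ (0, 1] and κ > 0, let f_hard: ℝ^d → ℝ be f_hard(x) = (1/2)x₁² + ∑_{i=2}^d ((κ/3)x_i² − (κh/3)cos(x_i/√h)), and fix any x ∈ ℝ^d. For g ∼ N(0, I_d), set x_g := x + √(2h)·g and S^x := −f_hard(x_g) + f_hard(x) − (1/2)⟨x − x_g, ∇f_hard(x) + ∇f_hard(x_g)⟩. Then, for d sufficiently large, with probability at least 1 − d⁻⁵ over g: S^x − E_g[S^x] ≤ 10·h·κ·√(d·log d). -/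
open MeasureTheory

noncomputable section

/-- The standard Gaussian `N(0, I_d)` on `Fin d → ℝ`. -/
def stdGaussianPi (d : ℕ) : Measure (Fin d → ℝ) :=
  Measure.pi fun _ : Fin d => ProbabilityTheory.gaussianReal 0 1

/-- The coordinate functions of the hard distribution: `f₁(c) = c²/2` and
`fᵢ(c) = (κ/3)c² − (κh/3)cos(c/√h)` for `i ≠ 1`. -/
def fhard1d {d : ℕ} [NeZero d] (κ h : ℝ) (i : Fin d) : ℝ → ℝ :=
  fun c => if i = 0 then (1 / 2) * c ^ 2
    else (κ / 3) * c ^ 2 - (κ * h / 3) * Real.cos (c / Real.sqrt h)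

/-- The hard separable function `f_hard(x) = ∑ᵢ fᵢ(xᵢ)`. -/
def fhard {d : ℕ} [NeZero d] (κ h : ℝ) (x : Fin d → ℝ) : ℝ := ∑ i, fhard1d κ h i (x i)

/-- The log-acceptance random variable
`Sˣ = −f_hard(x_g) + f_hard(x) − (1/2)⟨x − x_g, ∇f_hard(x) + ∇f_hard(x_g)⟩`,
as a function of `g`, where `x_g = x + √(2h)·g`. -/
def Stot {d : ℕ} [NeZero d] (κ h : ℝ) (x : Fin d → ℝ) (g : Fin d → ℝ) : ℝ :=
  -fhard κ h (fun i => x i + Real.sqrt (2 * h) * g i) + fhard κ h x -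
    (1 / 2) * ∑ i, (x i - (x i + Real.sqrt (2 * h) * g i)) *
      (deriv (fhard1d κ h i) (x i) + deriv (fhard1d κ h i) (x i + Real.sqrt (2 * h) * g i))

/-- The normalized contribution of one coordinate of the hard function to `Sˣ`. -/
def hardCoord (u g : ℝ) : ℝ :=
  Real.cos (u + Real.sqrt 2 * g) - Real.cos u +
    g / Real.sqrt 2 * (Real.sin u + Real.sin (u + Real.sqrt 2 * g))

lemma continuous_hardCoord (u : ℝ) : Continuous (hardCoord u) := by
  unfold hardCoord
  fun_prop

lemma hardCoord_sq_le (u g : ℝ) : hardCoord u g ^ 2 ≤ 4 + 2 * g ^ 2 := by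
  have h2 : Real.sqrt 2 ^ 2 = 2 := Real.sq_sqrt (by norm_num)
  have h2pos : 0 < Real.sqrt 2 := by positivity
  set w := g / Real.sqrt 2 with hw
  have hg : Real.sqrt 2 * g = 2 * w := by
    rw [hw]
    field_simp
    rw [h2, mul_comm]
  have hw2 : w ^ 2 = g ^ 2 / 2 := by rw [hw, div_pow, h2]
  have hT : hardCoord u g =
      2 * Real.sin (u + w) * (w * Real.cos w - Real.sin w) := by
    have e1 : u + 2 * w = (u + w) + w := by ring
    have e2 : Real.cos u = Real.cos ((u + w) - w) := by ring_nf
    have e3 : Real.sin u = Real.sin ((u + w) - w) := by ring_nf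
    unfold hardCoord
    rw [hg, ← hw, e1, e2, e3, Real.cos_add (u + w) w, Real.sin_add (u + w) w,
      Real.cos_sub, Real.sin_sub]
    ring
  have hcs : (w * Real.cos w - Real.sin w) ^ 2 ≤ 1 + w ^ 2 := by
    nlinarith [sq_nonneg (w * Real.sin w + Real.cos w), Real.sin_sq_add_cos_sq w]
  calc hardCoord u g ^ 2
      = 4 * (Real.sin (u + w) ^ 2 * (w * Real.cos w - Real.sin w) ^ 2) := by rw [hT]; ring
    _ ≤ 4 * (1 * (1 + w ^ 2)) := by
        gcongr
        exact Real.sin_sq_le_one _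
    _ = 4 + 2 * g ^ 2 := by rw [hw2]; ring

lemma exp_le_self_add_exp_sq (x : ℝ) : Real.exp x ≤ x + Real.exp (x ^ 2) := by
  have hsq := Real.add_one_le_exp (x ^ 2)
  rcases le_or_gt |x| 1 with hx | hx
  · have := (abs_le.mp (Real.abs_exp_sub_one_sub_id_le hx)).2
    linarith
  · rcases lt_abs.mp hx with hx | hx
    · have : Real.exp x ≤ Real.exp (x ^ 2) := Real.exp_le_exp.mpr (by nlinarith)
      linarith
    · have : Real.exp x ≤ 1 := Real.exp_le_one_iff.mpr (by linarith)
      nlinarith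

section Gaussian

open ProbabilityTheory

lemma integral_exp_mul_sq_gaussianReal {c : ℝ} (hc : c < 1 / 2) :
    ∫ g, Real.exp (c * g ^ 2) ∂gaussianReal 0 1 = (Real.sqrt (1 - 2 * c))⁻¹ := by
  rw [integral_gaussianReal_eq_integral_smul one_ne_zero]
  have hpt : ∀ g : ℝ, gaussianPDFReal 0 1 g • Real.exp (c * g ^ 2) =
      (Real.sqrt (2 * Real.pi))⁻¹ * Real.exp (-(1 / 2 - c) * g ^ 2) := by
    intro g
    rw [gaussianPDFReal, smul_eq_mul, mul_assoc, ← Real.exp_add]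
    simp only [NNReal.coe_one, mul_one, sub_zero]
    congr 2
    ring
  simp_rw [hpt]
  rw [integral_const_mul, integral_gaussian, ← Real.sqrt_inv, ← Real.sqrt_inv,
    ← Real.sqrt_mul (by positivity)]
  congr 1
  have : 1 / 2 - c ≠ 0 := by linarith
  have : 1 - 2 * c ≠ 0 := by linarith
  have := Real.pi_ne_zero
  field_simp

lemma integrable_exp_mul_sq_gaussianReal {c : ℝ} (hc : c < 1 / 2) :
    Integrable (fun g : ℝ => Real.exp (c * g ^ 2)) (gaussianReal 0 1) := by
  apply Integrable.of_integral_ne_zero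
  rw [integral_exp_mul_sq_gaussianReal hc]
  have : 0 < 1 - 2 * c := by linarith
  positivity

lemma integral_exp_mul_sq_gaussianReal_le {c : ℝ} (hc0 : 0 ≤ c) (hc : c ≤ 1 / 4) :
    ∫ g, Real.exp (c * g ^ 2) ∂gaussianReal 0 1 ≤ Real.exp (2 * c) := by
  rw [integral_exp_mul_sq_gaussianReal (by linarith)]
  have hpos : 0 < 1 - 2 * c := by linarith
  refine inv_le_of_inv_le₀ (Real.exp_pos _) ?_
  rw [← Real.exp_neg]
  apply Real.le_sqrt_of_sq_le
  rw [← Real.exp_nat_mul]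
  have hE : Real.exp (((2 : ℕ) : ℝ) * -(2 * c)) = (Real.exp (4 * c))⁻¹ := by
    rw [← Real.exp_neg]
    congr 1
    push_cast
    ring
  rw [hE]
  refine inv_le_of_inv_le₀ hpos ?_
  have := Real.add_one_le_exp (4 * c)
  rw [inv_le_iff_one_le_mul₀ hpos]
  nlinarith

lemma memLp_two_of_sq_le {φ : ℝ → ℝ} (hφ : Measurable φ)
    (hb : ∀ g, φ g ^ 2 ≤ 4 + 2 * g ^ 2) : MemLp φ 2 (gaussianReal 0 1) := by
  have hid : MemLp (id : ℝ → ℝ) 2 (gaussianReal 0 1) := by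
    exact_mod_cast memLp_id_gaussianReal (μ := 0) (v := 1) 2
  rw [memLp_two_iff_integrable_sq hφ.aestronglyMeasurable]
  refine Integrable.mono' ((integrable_const 4).add (hid.integrable_sq.const_mul 2))
    (hφ.pow_const 2).aestronglyMeasurable (Filter.Eventually.of_forall fun g => ?_)
  rw [Real.norm_of_nonneg (sq_nonneg _)]
  exact hb g

lemma integral_sq_le_of_sq_le {φ : ℝ → ℝ} (hφ : Measurable φ)
    (hb : ∀ g, φ g ^ 2 ≤ 4 + 2 * g ^ 2) : (∫ g, φ g ∂gaussianReal 0 1) ^ 2 ≤ 6 := by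
  have hid : MemLp (id : ℝ → ℝ) 2 (gaussianReal 0 1) := by
    exact_mod_cast memLp_id_gaussianReal (μ := 0) (v := 1) 2
  have hL := memLp_two_of_sq_le hφ hb
  have hvar := variance_eq_sub hL
  have hnn := variance_nonneg φ (gaussianReal 0 1)
  have hone : ∫ g : ℝ, g ^ 2 ∂gaussianReal 0 1 = 1 := by
    have := variance_eq_sub hid
    rw [variance_id_gaussianReal] at this
    simpa using this.symm
  have hle : ∫ g, (φ ^ 2) g ∂gaussianReal 0 1 ≤ ∫ g : ℝ, (4 + 2 * g ^ 2) ∂gaussianReal 0 1 :=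
    integral_mono hL.integrable_sq
      ((integrable_const 4).add (hid.integrable_sq.const_mul 2)) hb
  have hsix : ∫ g : ℝ, (4 + 2 * g ^ 2) ∂gaussianReal 0 1 = 6 := by
    have hsq : Integrable (fun g : ℝ => g ^ 2) (gaussianReal 0 1) := hid.integrable_sq
    rw [integral_add (integrable_const 4) (hsq.const_mul 2), integral_const_mul, hone,
      integral_const, probReal_univ]
    norm_num
  linarith

lemma exp_mul_centered_le {φ : ℝ → ℝ} (hφ : Measurable φ)
    (hb : ∀ g, φ g ^ 2 ≤ 4 + 2 * g ^ 2) (t g : ℝ) :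
    Real.exp (t * (φ g - ∫ y, φ y ∂gaussianReal 0 1)) ≤
      t * (φ g - ∫ y, φ y ∂gaussianReal 0 1) +
        Real.exp (20 * t ^ 2) * Real.exp (4 * t ^ 2 * g ^ 2) := by
  have hm := integral_sq_le_of_sq_le hφ hb
  set m := ∫ y, φ y ∂gaussianReal 0 1
  refine (exp_le_self_add_exp_sq _).trans ?_
  rw [← Real.exp_add]
  gcongr
  have : (φ g - m) ^ 2 ≤ 20 + 4 * g ^ 2 := by nlinarith [hb g, sq_nonneg (φ g + m)]
  nlinarith [mul_le_mul_of_nonneg_left this (sq_nonneg t)]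

lemma integrable_exp_mul_centered {φ : ℝ → ℝ} (hφ : Measurable φ)
    (hb : ∀ g, φ g ^ 2 ≤ 4 + 2 * g ^ 2) {t : ℝ} (ht : t ^ 2 ≤ 1 / 16) :
    Integrable (fun g => Real.exp (t * (φ g - ∫ y, φ y ∂gaussianReal 0 1)))
      (gaussianReal 0 1) := by
  have hint := (memLp_two_of_sq_le hφ hb).integrable one_le_two
  refine Integrable.mono'
    (((hint.sub (integrable_const (∫ y, φ y ∂gaussianReal 0 1))).const_mul t).add
    ((integrable_exp_mul_sq_gaussianReal (c := 4 * t ^ 2) (by linarith)).const_mul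
      (Real.exp (20 * t ^ 2)))) (by fun_prop) (Filter.Eventually.of_forall fun g => ?_)
  rw [Real.norm_of_nonneg (Real.exp_pos _).le]
  exact exp_mul_centered_le hφ hb t g

lemma integral_exp_mul_centered_le {φ : ℝ → ℝ} (hφ : Measurable φ)
    (hb : ∀ g, φ g ^ 2 ≤ 4 + 2 * g ^ 2) {t : ℝ} (ht : t ^ 2 ≤ 1 / 16) :
    ∫ g, Real.exp (t * (φ g - ∫ y, φ y ∂gaussianReal 0 1)) ∂gaussianReal 0 1 ≤
      Real.exp (28 * t ^ 2) := by
  have hint := (memLp_two_of_sq_le hφ hb).integrable one_le_two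
  have h1 : Integrable (fun g => t * (φ g - ∫ y, φ y ∂gaussianReal 0 1)) (gaussianReal 0 1) :=
    (hint.sub (integrable_const _)).const_mul t
  have h2 := (integrable_exp_mul_sq_gaussianReal (c := 4 * t ^ 2) (by linarith)).const_mul
    (Real.exp (20 * t ^ 2))
  have hmono := integral_mono (integrable_exp_mul_centered hφ hb ht) (h1.add h2)
    (exp_mul_centered_le hφ hb t)
  refine hmono.trans ?_
  simp only [Pi.add_apply]
  rw [integral_add h1 h2, integral_const_mul, integral_const_mul, integral_sub hint (integrable_const _)]
  have h3 := integral_exp_mul_sq_gaussianReal_le (c := 4 * t ^ 2) (by positivity) (by linarith)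
  calc _ = Real.exp (20 * t ^ 2) * ∫ g, Real.exp (4 * t ^ 2 * g ^ 2) ∂gaussianReal 0 1 := by simp
    _ ≤ Real.exp (20 * t ^ 2) * Real.exp (2 * (4 * t ^ 2)) := by gcongr
    _ = Real.exp (28 * t ^ 2) := by rw [← Real.exp_add]; ring_nf

instance isProbabilityMeasure_stdGaussianPi (d : ℕ) :
    IsProbabilityMeasure (stdGaussianPi d) := by
  unfold stdGaussianPi
  infer_instance

/-- A Chernoff bound for a sum of independent functions of Gaussians with linear growth. -/
lemma stdGaussianPi_centered_sum_ge_le {d : ℕ} {φ : Fin d → ℝ → ℝ}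
    (hφ : ∀ i, Measurable (φ i)) (hb : ∀ i g, φ i g ^ 2 ≤ 4 + 2 * g ^ 2)
    {t : ℝ} (ht0 : 0 ≤ t) (ht : t ^ 2 ≤ 1 / 16) (ε : ℝ) :
    (stdGaussianPi d).real
        {g | ε ≤ ∑ i, (φ i (g i) - ∫ y, φ i y ∂gaussianReal 0 1)} ≤
      Real.exp (-t * ε + d * (28 * t ^ 2)) := by
  have hexp : ∀ g : Fin d → ℝ,
      Real.exp (t * ∑ i, (φ i (g i) - ∫ y, φ i y ∂gaussianReal 0 1)) =
        ∏ i, Real.exp (t * (φ i (g i) - ∫ y, φ i y ∂gaussianReal 0 1)) := fun g => by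
    rw [Finset.mul_sum, Real.exp_sum]
  have hint : Integrable (fun g : Fin d → ℝ =>
      Real.exp (t * ∑ i, (φ i (g i) - ∫ y, φ i y ∂gaussianReal 0 1))) (stdGaussianPi d) := by
    simp_rw [hexp]
    exact Integrable.fintype_prod fun i => integrable_exp_mul_centered (hφ i) (hb i) ht
  refine (measure_ge_le_exp_mul_mgf ε ht0 hint).trans ?_
  rw [Real.exp_add]
  gcongr
  simp_rw [mgf, hexp]
  unfold stdGaussianPi
  rw [integral_fintype_prod_eq_prod
    (f := fun i g => Real.exp (t * (φ i g - ∫ y, φ i y ∂gaussianReal 0 1)))]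
  calc _ ≤ ∏ _i : Fin d, Real.exp (28 * t ^ 2) :=
        Finset.prod_le_prod (fun i _ => integral_nonneg fun g => (Real.exp_pos _).le)
          fun i _ => integral_exp_mul_centered_le (hφ i) (hb i) ht
    _ = Real.exp (d * (28 * t ^ 2)) := by
        rw [Finset.prod_const, Finset.card_univ, Fintype.card_fin, ← Real.exp_nat_mul]

lemma stdGaussianPi_centered_sum_le {d : ℕ} [NeZero d] {φ : Fin d → ℝ → ℝ}
    (hφ : ∀ i, Measurable (φ i)) (hb : ∀ i g, φ i g ^ 2 ≤ 4 + 2 * g ^ 2) :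
    ENNReal.ofReal (1 - ((d : ℝ) ^ 5)⁻¹) ≤
      stdGaussianPi d {g | ∑ i, (φ i (g i) - ∫ y, φ i y ∂gaussianReal 0 1) ≤
        30 * Real.sqrt (d * Real.log d)} := by
  have hd : (1 : ℝ) ≤ d := by exact_mod_cast NeZero.one_le
  have hd0 : (0 : ℝ) < d := by linarith
  have hlog : 0 ≤ Real.log d := Real.log_nonneg hd
  set s := Real.sqrt (d * Real.log d) with hs
  have hs2 : s ^ 2 = d * Real.log d := Real.sq_sqrt (by positivity)
  have hlogd : Real.log d ≤ d := (Real.log_le_sub_one_of_pos hd0).trans (by linarith)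
  have ht2 : (s / (4 * d)) ^ 2 = Real.log d / (16 * d) := by
    rw [div_pow, hs2]
    field_simp
    norm_num
  have hbound := stdGaussianPi_centered_sum_ge_le hφ hb (t := s / (4 * d)) (by positivity)
    (by rw [ht2, div_le_div_iff₀ (by positivity) (by norm_num)]; linarith) (30 * s)
  have hexp : Real.exp (-(s / (4 * d)) * (30 * s) + d * (28 * (s / (4 * d)) ^ 2)) ≤
      ((d : ℝ) ^ 5)⁻¹ := by
    have h1 : -(s / (4 * d)) * (30 * s) = -(15 / 2 * Real.log d) := by
      have : -(s / (4 * d)) * (30 * s) = -(15 / 2 * (s ^ 2 / d)) := by ring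
      rw [this, hs2, mul_div_cancel_left₀ _ hd0.ne']
    have h2 : d * (28 * (s / (4 * d)) ^ 2) = 7 / 4 * Real.log d := by
      rw [ht2]
      field_simp
      ring
    rw [h1, h2, ← Real.exp_log (inv_pos.mpr (pow_pos hd0 5)), Real.log_inv, Real.log_pow]
    gcongr
    push_cast
    linarith
  set X : (Fin d → ℝ) → ℝ := fun g => ∑ i, (φ i (g i) - ∫ y, φ i y ∂gaussianReal 0 1) with hX
  have hmeas : Measurable X := by fun_prop
  have hset : MeasurableSet {g | 30 * s ≤ X g} := measurableSet_le measurable_const hmeas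
  have hcompl := probReal_compl_eq_one_sub (μ := stdGaussianPi d) hset
  calc ENNReal.ofReal (1 - ((d : ℝ) ^ 5)⁻¹)
      ≤ ENNReal.ofReal ((stdGaussianPi d).real {g | 30 * s ≤ X g}ᶜ) := by
        apply ENNReal.ofReal_le_ofReal
        rw [hcompl]
        linarith
    _ = stdGaussianPi d {g | 30 * s ≤ X g}ᶜ := ofReal_measureReal
    _ ≤ stdGaussianPi d {g | X g ≤ 30 * s} := measure_mono fun g hg => by
        rw [Set.mem_compl_iff, Set.mem_ofPred_eq, not_le] at hg
        exact hg.le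

end Gaussian

lemma deriv_fhard1d_zero {d : ℕ} [NeZero d] (κ h c : ℝ) :
    deriv (fhard1d κ h (0 : Fin d)) c = c := by
  have : HasDerivAt (fun c : ℝ => (1 / 2) * c ^ 2) ((1 / 2) * (2 * c)) c := by
    simpa using (hasDerivAt_pow 2 c).const_mul (1 / 2 : ℝ)
  have hf : fhard1d κ h (0 : Fin d) = fun c : ℝ => (1 / 2) * c ^ 2 := by
    ext c
    simp [fhard1d]
  rw [hf, this.deriv]
  ring

lemma deriv_fhard1d_of_ne {d : ℕ} [NeZero d] (κ h c : ℝ) {i : Fin d} (hi : i ≠ 0) :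
    deriv (fhard1d κ h i) c =
      (κ / 3) * (2 * c) + (κ * h / 3) * (Real.sin (c / Real.sqrt h) / Real.sqrt h) := by
  have h1 : HasDerivAt (fun c : ℝ => (κ / 3) * c ^ 2) ((κ / 3) * (2 * c)) c := by
    simpa using (hasDerivAt_pow 2 c).const_mul (κ / 3)
  have h2 := (((hasDerivAt_id c).div_const (Real.sqrt h)).cos).const_mul (κ * h / 3)
  have hf : fhard1d κ h i =
      fun c : ℝ => (κ / 3) * c ^ 2 - (κ * h / 3) * Real.cos (c / Real.sqrt h) := by
    ext c
    simp [fhard1d, hi]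
  rw [hf]
  refine (h1.sub h2).deriv.trans ?_
  simp only [id_eq]
  ring

/-- The quadratic parts cancel, leaving a sum of functions of the separate coordinates. -/
lemma Stot_eq_sum {d : ℕ} [NeZero d] {κ h : ℝ} (hh : 0 < h) (x g : Fin d → ℝ) :
    Stot κ h x g =
      κ * h / 3 * ∑ i, if i = 0 then 0 else hardCoord (x i / Real.sqrt h) (g i) := by
  unfold Stot fhard
  rw [Finset.mul_sum, Finset.mul_sum, ← Finset.sum_neg_distrib, ← Finset.sum_add_distrib,
    ← Finset.sum_sub_distrib]
  refine Finset.sum_congr rfl fun i _ => ?_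
  by_cases hi : i = 0
  · subst hi
    rw [deriv_fhard1d_zero, deriv_fhard1d_zero]
    simp only [fhard1d, if_true]
    ring
  · rw [deriv_fhard1d_of_ne _ _ _ hi, deriv_fhard1d_of_ne _ _ _ hi]
    simp only [fhard1d, hi, if_false, hardCoord]
    rw [Real.sqrt_mul zero_le_two]
    have hr : 0 < Real.sqrt h := Real.sqrt_pos.mpr hh
    have hv : (x i + Real.sqrt 2 * Real.sqrt h * g i) / Real.sqrt h =
        x i / Real.sqrt h + Real.sqrt 2 * g i := by field_simp
    have hg : g i / Real.sqrt 2 = Real.sqrt 2 * g i / 2 := by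
      have h2 : Real.sqrt 2 ^ 2 = 2 := Real.sq_sqrt (by norm_num)
      have : 0 < Real.sqrt 2 := by positivity
      field_simp
      rw [h2]
    rw [hv, hg]
    field_simp
    ring

theorem hard_concentration :
    ∃ d₀ : ℕ, ∀ (d : ℕ) [NeZero d], d₀ ≤ d → ∀ κ h : ℝ, 0 < κ → 0 < h → h ≤ 1 →
      ∀ x : Fin d → ℝ,
        ENNReal.ofReal (1 - ((d : ℝ) ^ 5)⁻¹) ≤
          stdGaussianPi d {g : Fin d → ℝ |
            Stot κ h x g - (∫ g', Stot κ h x g' ∂(stdGaussianPi d)) ≤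
              10 * h * κ * Real.sqrt (d * Real.log d)} := by
  refine ⟨0, fun d _ _ κ h hκ hh _ x => ?_⟩
  set φ : Fin d → ℝ → ℝ := fun i y =>
    if i = 0 then 0 else hardCoord (x i / Real.sqrt h) y with hφdef
  have hφ : ∀ i, Measurable (φ i) := fun i => by
    by_cases hi : i = 0
    · simp [hφdef, hi]
    · simpa [hφdef, hi] using (continuous_hardCoord _).measurable
  have hb : ∀ i g, φ i g ^ 2 ≤ 4 + 2 * g ^ 2 := fun i g => by
    by_cases hi : i = 0
    · simp only [hφdef, hi, if_true]
      nlinarith [sq_nonneg g]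
    · simpa only [hφdef, hi, if_false] using hardCoord_sq_le _ g
  have hS : ∀ g, Stot κ h x g = κ * h / 3 * ∑ i, φ i (g i) := Stot_eq_sum hh x
  have hmean : ∫ g, Stot κ h x g ∂stdGaussianPi d =
      κ * h / 3 * ∑ i, ∫ y, φ i y ∂ProbabilityTheory.gaussianReal 0 1 := by
    simp_rw [hS]
    unfold stdGaussianPi
    rw [integral_const_mul, integral_finsetSum _ fun i _ => integrable_comp_eval
      ((memLp_two_of_sq_le (hφ i) (hb i)).integrable one_le_two)]
    congr 1
    exact Finset.sum_congr rfl fun i _ => integral_comp_eval (hφ i).aestronglyMeasurable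
  refine (stdGaussianPi_centered_sum_le hφ hb).trans (measure_mono fun g hg => ?_)
  rw [Set.mem_ofPred_eq, Finset.sum_sub_distrib] at hg
  rw [Set.mem_ofPred_eq, hmean, hS]
  have := mul_le_mul_of_nonneg_left hg (by positivity : 0 ≤ κ * h / 3)
  linarith
end
end

section
/- Fix κ ≥ 10 and h ≤ 1/(10000π²κ), let f_hard(x) = (1/2)x₁² + ∑_{i=2}^d ((κ/3)x_i² − (κh/3)cos(x_i/√h)), let π* be the probability distribution on ℝ^d with density proportional to exp(−f_hard), and let Ω_hard = {x ∈ ℝ^d : |x₁| ≤ 2, and for each 2 ≤ i ≤ d there exists an integer k_i with |k_i| ≤ ⌊5/(π√(hκ))⌋ such that −(9/20)π√h + 2πk_i√h ≤ x_i ≤ (9/20)π√h + 2πk_i√h}. Then π*(Ω_hard) ≥ exp(−d), and for every x ∈ Ω_hard, ‖∇f_hard(x)‖ ≤ 10√(κd). -/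
open MeasureTheory

noncomputable section

/-- The probability distribution with density proportional to `exp (-f_hard)`. -/
def piStar (d : ℕ) [NeZero d] (κ h : ℝ) : Measure (Fin d → ℝ) :=
  (((volume : Measure (Fin d → ℝ)).withDensity
      fun x => ENNReal.ofReal (Real.exp (-fhard κ h x))) Set.univ)⁻¹ •
    (volume : Measure (Fin d → ℝ)).withDensity
      fun x => ENNReal.ofReal (Real.exp (-fhard κ h x))

/-- The bad set `Ω_hard`. -/
def OmegaHard (d : ℕ) [NeZero d] (κ h : ℝ) : Set (Fin d → ℝ) :=
  {x | |x 0| ≤ 2 ∧ ∀ i : Fin d, i ≠ 0 → ∃ k : ℤ,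
    |k| ≤ ⌊5 / (Real.pi * Real.sqrt (h * κ))⌋ ∧
    -(9 / 20) * Real.pi * Real.sqrt h + 2 * Real.pi * k * Real.sqrt h ≤ x i ∧
    x i ≤ (9 / 20) * Real.pi * Real.sqrt h + 2 * Real.pi * k * Real.sqrt h}

/-- The average of an antitone function over an initial segment dominates its total average. -/
theorem AntitoneOn.mul_intervalIntegral_le {g : ℝ → ℝ} (hg : Continuous g) {a L θ : ℝ}
    (hL : 0 ≤ L) (hθ0 : 0 ≤ θ) (hθ1 : θ ≤ 1) (hanti : AntitoneOn g (Set.Icc a (a + L))) :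
    θ * ∫ x in a..(a + L), g x ≤ ∫ x in a..(a + θ * L), g x := by
  have h1 := intervalIntegral.smul_integral_comp_add_mul (a := 0) (b := L) g θ a
  have h2 := intervalIntegral.integral_comp_add_left (a := 0) (b := L) g a
  simp only [mul_zero, add_zero, smul_eq_mul] at h1 h2
  rw [← h1, ← h2]
  refine mul_le_mul_of_nonneg_left ?_ hθ0
  refine intervalIntegral.integral_mono_on hL
    (Continuous.intervalIntegrable (by fun_prop) _ _)
    (Continuous.intervalIntegrable (by fun_prop) _ _) fun x hx => ?_
  have : θ * x ≤ x := mul_le_of_le_one_left hx.1 hθ1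
  have : 0 ≤ θ * x := mul_nonneg hθ0 hx.1
  exact hanti ⟨by linarith, by linarith [hx.2]⟩ ⟨by linarith [hx.1], by linarith [hx.2]⟩
    (by linarith)

/-- A set containing the central `θ`-fraction of each of `n` consecutive cells of length `δ` carries
at least a `θ`-fraction of the integral of an antitone function over those cells. -/
theorem mul_intervalIntegral_le_indicator {g : ℝ → ℝ} (hg : Continuous g) (hg0 : ∀ x, 0 ≤ g x)
    (hanti : AntitoneOn g (Set.Ici 0)) {S : Set ℝ} (hS : MeasurableSet S) {δ θ : ℝ}
    (hδ : 0 ≤ δ) (hθ0 : 0 ≤ θ) (hθ1 : θ ≤ 1) (n : ℕ)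
    (hsub : ∀ k : ℕ, k < n →
      Set.Icc ((k + (1 - θ / 2)) * δ) ((k + (1 - θ / 2)) * δ + θ * δ) ⊆ S) :
    θ * ∫ x in ((1 - θ / 2) * δ)..((n + (1 - θ / 2)) * δ), g x ≤
      ∫ x in ((1 - θ / 2) * δ)..((n + (1 - θ / 2)) * δ), S.indicator g x := by
  have hSi : ∀ a b : ℝ, IntervalIntegrable (S.indicator g) volume a b := fun a b =>
    ⟨(hg.intervalIntegrable a b).1.indicator hS, (hg.intervalIntegrable a b).2.indicator hS⟩
  have e1 := intervalIntegral.sum_integral_adjacent_intervals (μ := volume) (f := g)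
    (a := fun k : ℕ => (k + (1 - θ / 2)) * δ) (n := n)
    (fun k _ => hg.intervalIntegrable _ _)
  have e2 := intervalIntegral.sum_integral_adjacent_intervals (μ := volume) (f := S.indicator g)
    (a := fun k : ℕ => (k + (1 - θ / 2)) * δ) (n := n)
    (fun k _ => hSi _ _)
  simp only [Nat.cast_zero, zero_add] at e1 e2
  rw [← e1, ← e2, Finset.mul_sum]
  refine Finset.sum_le_sum fun k hk => ?_
  have hk := hsub k (Finset.mem_range.1 hk)
  have hnext : ((k + 1 : ℕ) + (1 - θ / 2)) * δ = (k + (1 - θ / 2)) * δ + δ := by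
    push_cast; ring
  rw [hnext]
  set a := (k + (1 - θ / 2)) * δ with ha
  have ha0 : 0 ≤ a := by
    have : (0 : ℝ) ≤ k := k.cast_nonneg
    have : 0 ≤ 1 - θ / 2 := by linarith
    positivity
  have hθδ : θ * δ ≤ δ := mul_le_of_le_one_left hδ hθ1
  have hθδ0 : 0 ≤ θ * δ := by positivity
  calc θ * ∫ x in a..(a + δ), g x ≤ ∫ x in a..(a + θ * δ), g x :=
        AntitoneOn.mul_intervalIntegral_le hg hδ hθ0 hθ1
          (hanti.mono fun x hx => ha0.trans hx.1)
    _ = ∫ x in a..(a + θ * δ), S.indicator g x := by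
        refine intervalIntegral.integral_congr fun x hx => ?_
        rw [Set.uIcc_of_le (by linarith)] at hx
        exact (Set.indicator_of_mem (hk hx) g).symm
    _ ≤ ∫ x in a..(a + δ), S.indicator g x :=
        intervalIntegral.integral_mono_interval le_rfl (by linarith) (by linarith)
          (Filter.Eventually.of_forall fun x => Set.indicator_nonneg (fun x _ => hg0 x) x) (hSi _ _)

theorem setIntegral_gaussian_tail_le {b u R : ℝ} (hu : 0 < u) (hb : u ^ 2 / 3 = b)
    (hR : 9 ≤ u * R) :
    ∫ x in Set.Ioi R, Real.exp (-b * x ^ 2) ≤ 1 / (84 * u) := by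
  have hb0 : 0 < b := by rw [← hb]; positivity
  calc ∫ x in Set.Ioi R, Real.exp (-b * x ^ 2)
      ≤ ∫ x in Set.Ioi R, Real.exp ((-(3 * u)) * x) := by
        refine setIntegral_mono_on (integrable_exp_neg_mul_sq hb0).integrableOn ?_
          measurableSet_Ioi fun x hx => ?_
        · exact integrableOn_exp_mul_Ioi (by linarith) R
        · refine Real.exp_le_exp.2 ?_
          have : 9 ≤ u * x := hR.trans (mul_le_mul_of_nonneg_left (le_of_lt hx) hu.le)
          rw [← hb]
          nlinarith
    _ = Real.exp (-(3 * u) * R) / (3 * u) := by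
        rw [integral_exp_mul_Ioi (by linarith)]
        field_simp
    _ ≤ (1 / 28) / (3 * u) := by
        gcongr
        have h28 : (28 : ℝ) ≤ Real.exp (3 * u * R) := by
          linarith [Real.add_one_le_exp (3 * u * R)]
        rw [show -(3 * u) * R = -(3 * u * R) by ring, Real.exp_neg, ← one_div]
        exact one_div_le_one_div_of_le (by norm_num) h28
    _ = 1 / (84 * u) := by field_simp; norm_num

/-- The set of admissible values of a coordinate other than the first. -/
def wells (K : ℤ) (s : ℝ) : Set ℝ :=
  {c | ∃ k : ℤ, |k| ≤ K ∧ -(9 / 20) * Real.pi * s + 2 * Real.pi * k * s ≤ c ∧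
    c ≤ (9 / 20) * Real.pi * s + 2 * Real.pi * k * s}

theorem measurableSet_wells (K : ℤ) (s : ℝ) : MeasurableSet (wells K s) := by
  have : wells K s = ⋃ k : ℤ, ⋃ _ : |k| ≤ K,
      Set.Icc (-(9 / 20) * Real.pi * s + 2 * Real.pi * k * s)
        ((9 / 20) * Real.pi * s + 2 * Real.pi * k * s) := by
    ext c
    simp only [wells, Set.mem_iUnion, exists_prop, Set.mem_Icc]
    rfl
  rw [this]
  exact MeasurableSet.iUnion fun k => MeasurableSet.iUnion fun _ => measurableSet_Icc

theorem neg_mem_wells {K : ℤ} {s c : ℝ} (hc : c ∈ wells K s) : -c ∈ wells K s := by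
  obtain ⟨k, hk, h1, h2⟩ := hc
  refine ⟨-k, by rwa [abs_neg], ?_, ?_⟩ <;> push_cast <;> linarith

theorem abs_mem_wells {K : ℤ} {s c : ℝ} : |c| ∈ wells K s ↔ c ∈ wells K s := by
  rcases abs_choice c with h | h <;> rw [h]
  exact ⟨fun hc => neg_neg c ▸ neg_mem_wells hc, neg_mem_wells⟩

theorem setIntegral_gaussian_wells_ge {u s : ℝ} (hu : 0 < u) (hs : 0 < s)
    (hus : Real.pi * (s * u) ≤ 1 / 100) :
    (2 / 5) * ∫ x, Real.exp (-(u ^ 2 / 3) * x ^ 2) ≤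
      ∫ x in wells ⌊5 / (Real.pi * (s * u))⌋ s, Real.exp (-(u ^ 2 / 3) * x ^ 2) := by
  set K := ⌊5 / (Real.pi * (s * u))⌋ with hK
  set g : ℝ → ℝ := fun x => Real.exp (-(u ^ 2 / 3) * x ^ 2) with hgdef
  have hπ := Real.pi_pos
  have hg : Continuous g := by fun_prop
  have hg0 : ∀ x, 0 ≤ g x := fun x => (Real.exp_pos _).le
  have hgi : Integrable g := integrable_exp_neg_mul_sq (by positivity)
  have hS := measurableSet_wells K s
  have hanti : AntitoneOn g (Set.Ici 0) := fun x hx y hy hxy => by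
    refine Real.exp_le_exp.2 ?_
    have : x ^ 2 ≤ y ^ 2 := pow_le_pow_left₀ hx hxy 2
    nlinarith [sq_nonneg u]
  have hK0 : 0 ≤ K := Int.floor_nonneg.2 (by positivity)
  obtain ⟨n, hn⟩ := Int.eq_ofNat_of_zero_le hK0
  set δ := 2 * Real.pi * s with hδ
  have hδ0 : 0 < δ := by positivity
  have hδu : δ * u ≤ 1 / 50 := by rw [hδ]; linarith
  have hcell := mul_intervalIntegral_le_indicator hg hg0 hanti hS (θ := 9 / 20) hδ0.le
    (by norm_num) (by norm_num) n (by
      intro k hk x hx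
      refine ⟨(k : ℤ) + 1, ?_, ?_, ?_⟩
      · rw [abs_of_nonneg (by positivity), hn]; omega
      · have := hx.1; push_cast; rw [hδ] at this; linarith
      · have := hx.2; push_cast; rw [hδ] at this; linarith)
  set a := (1 - 9 / 20 / 2) * δ with ha
  set R := ((n : ℝ) + (1 - 9 / 20 / 2)) * δ with hR
  have ha0 : 0 ≤ a := by rw [ha]; linarith
  have haR : a ≤ R := by
    rw [ha, hR]
    exact mul_le_mul_of_nonneg_right (by linarith [n.cast_nonneg (α := ℝ)]) hδ0.le
  have huR : 9 ≤ u * R := by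
    have h1 : 5 / (Real.pi * (s * u)) < (n : ℝ) + 1 := by
      have := Int.lt_floor_add_one (5 / (Real.pi * (s * u)))
      rw [← hK, hn] at this
      exact_mod_cast this
    rw [div_lt_iff₀ (by positivity)] at h1
    have : u * R = 2 * (((n : ℝ) + 1) * (Real.pi * (s * u))) - 9 / 40 * (δ * u) := by
      rw [hR, hδ]; ring
    linarith
  have htail : ∫ x in Set.Ioi R, g x ≤ 1 / (84 * u) := setIntegral_gaussian_tail_le hu rfl huR
  have hhead : ∫ x in (0 : ℝ)..a, g x ≤ a := by
    have := intervalIntegral.integral_mono_on (μ := volume) ha0 (hg.intervalIntegrable 0 a)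
      (continuous_const.intervalIntegrable 0 a) (g := fun _ => (1 : ℝ)) (fun x _ =>
        Real.exp_le_one_iff.2 (by nlinarith [mul_nonneg (sq_nonneg u) (sq_nonneg x)]))
    simpa using this
  have hsplit : ∫ x in Set.Ioi 0, g x =
      (∫ x in (0 : ℝ)..a, g x) + (∫ x in a..R, g x) + ∫ x in Set.Ioi R, g x := by
    rw [intervalIntegral.integral_add_adjacent_intervals (hg.intervalIntegrable _ _)
      (hg.intervalIntegrable _ _)]
    exact (intervalIntegral.integral_interval_add_Ioi hgi.integrableOn hgi.integrableOn).symm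
  have hG : 3 / 2 / u ≤ ∫ x in Set.Ioi 0, g x := by
    rw [integral_gaussian_Ioi]
    have : 3 / u ≤ √(Real.pi / (u ^ 2 / 3)) := by
      refine Real.le_sqrt_of_sq_le ?_
      rw [div_pow, div_div_eq_mul_div]
      gcongr
      linarith [Real.pi_gt_three]
    calc 3 / 2 / u = 3 / u / 2 := by ring
      _ ≤ _ := by gcongr
  have hfull : ∫ x, g x = 2 * ∫ x in Set.Ioi 0, g x := by
    rw [← integral_comp_abs]
    simp [hgdef]
  have hwell : ∫ x in wells K s, g x = 2 * ∫ x in Set.Ioi 0, (wells K s).indicator g x := by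
    rw [← integral_indicator hS, ← integral_comp_abs]
    congr 1
    ext x
    by_cases hx : x ∈ wells K s
    · rw [Set.indicator_of_mem hx, Set.indicator_of_mem (abs_mem_wells.2 hx)]
      simp [hgdef]
    · rw [Set.indicator_of_notMem hx, Set.indicator_of_notMem (fun h => hx (abs_mem_wells.1 h))]
  have hsubset : ∫ x in a..R, (wells K s).indicator g x ≤
      ∫ x in Set.Ioi 0, (wells K s).indicator g x := by
    rw [intervalIntegral.integral_of_le haR]
    exact setIntegral_mono_set (hgi.indicator hS).integrableOn
      (Filter.Eventually.of_forall fun x => Set.indicator_nonneg (fun x _ => hg0 x) x)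
      (Filter.Eventually.of_forall fun x hx => lt_of_le_of_lt ha0 hx.1)
  have hau : a ≤ 1 / 60 / u := by
    rw [le_div_iff₀ hu, ha]
    nlinarith
  have ht : 1 / (84 * u) = 1 / 84 / u := by rw [div_div]
  have hui : 0 < 1 / u := by positivity
  rw [hfull, hwell]
  have e1 : 1 / 60 / u = 1 / 60 * (1 / u) := by ring
  have e2 : 1 / 84 / u = 1 / 84 * (1 / u) := by ring
  have e3 : 3 / 2 / u = 3 / 2 * (1 / u) := by ring
  rw [ht, e2] at htail
  rw [e1] at hau
  rw [e3] at hG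
  linarith

/-- Perturbing a potential by at most `c` changes relative masses by at most `exp (2 * c)`. -/
theorem setIntegral_exp_perturb_ge {f g : ℝ → ℝ} (hf : Continuous f)
    (hg : Integrable fun x => Real.exp (g x)) {c p : ℝ} (hp : 0 ≤ p)
    (hfg : ∀ x, |f x - g x| ≤ c) {S : Set ℝ}
    (hS : p * ∫ x, Real.exp (g x) ≤ ∫ x in S, Real.exp (g x)) :
    Integrable (fun x => Real.exp (f x)) ∧
      Real.exp (-(2 * c)) * p * ∫ x, Real.exp (f x) ≤ ∫ x in S, Real.exp (f x) := by
  have hup : ∀ x, Real.exp (f x) ≤ Real.exp c * Real.exp (g x) := fun x => by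
    rw [← Real.exp_add]
    exact Real.exp_le_exp.2 (by linarith [(abs_le.1 (hfg x)).2])
  have hlow : ∀ x, Real.exp (-c) * Real.exp (g x) ≤ Real.exp (f x) := fun x => by
    rw [← Real.exp_add]
    exact Real.exp_le_exp.2 (by linarith [(abs_le.1 (hfg x)).1])
  have hfi : Integrable (fun x => Real.exp (f x)) := by
    refine (hg.const_mul (Real.exp c)).mono' (by fun_prop) (Filter.Eventually.of_forall fun x => ?_)
    rw [Real.norm_of_nonneg (Real.exp_pos _).le]
    exact hup x
  refine ⟨hfi, ?_⟩
  calc Real.exp (-(2 * c)) * p * ∫ x, Real.exp (f x)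
      ≤ Real.exp (-(2 * c)) * p * ∫ x, Real.exp c * Real.exp (g x) := by
        exact mul_le_mul_of_nonneg_left (integral_mono hfi (hg.const_mul _) hup) (by positivity)
    _ = Real.exp (-c) * (p * ∫ x, Real.exp (g x)) := by
        rw [integral_const_mul, show -(2 * c) = -c + -c by ring, Real.exp_add, Real.exp_neg c]
        field_simp
    _ ≤ Real.exp (-c) * ∫ x in S, Real.exp (g x) := by gcongr
    _ = ∫ x in S, Real.exp (-c) * Real.exp (g x) := (integral_const_mul _ _).symm
    _ ≤ ∫ x in S, Real.exp (f x) :=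
        integral_mono (hg.const_mul _).integrableOn hfi.integrableOn hlow

theorem exp_neg_one_mul_integral_gaussian_le :
    Real.exp (-1) * ∫ x : ℝ, Real.exp (-((1 / 2) * x ^ 2)) ≤
      ∫ x in {c : ℝ | |c| ≤ 2}, Real.exp (-((1 / 2) * x ^ 2)) := by
  have hi : Integrable fun x : ℝ => Real.exp (-((1 / 2) * x ^ 2)) := by
    simpa only [neg_mul] using integrable_exp_neg_mul_sq (b := 1 / 2) (by norm_num)
  have htotal : ∫ x : ℝ, Real.exp (-((1 / 2) * x ^ 2)) ≤ 2.52 := by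
    have := integral_gaussian (1 / 2)
    simp only [neg_mul] at this
    rw [this, Real.sqrt_le_left (by norm_num)]
    linarith [Real.pi_lt_d2]
  have hpart : (1 : ℝ) ≤ ∫ x in {c : ℝ | |c| ≤ 2}, Real.exp (-((1 / 2) * x ^ 2)) := by
    have hmono : ∫ x in Set.Icc (-1 : ℝ) 1, (1 / 2 : ℝ) ≤
        ∫ x in Set.Icc (-1 : ℝ) 1, Real.exp (-((1 / 2) * x ^ 2)) := by
      refine setIntegral_mono_on (by simp) hi.integrableOn measurableSet_Icc fun x hx => ?_
      have : x ^ 2 ≤ 1 := by nlinarith [hx.1, hx.2]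
      linarith [Real.add_one_le_exp (-((1 / 2) * x ^ 2))]
    have hsub : ∫ x in Set.Icc (-1 : ℝ) 1, Real.exp (-((1 / 2) * x ^ 2)) ≤
        ∫ x in {c : ℝ | |c| ≤ 2}, Real.exp (-((1 / 2) * x ^ 2)) :=
      setIntegral_mono_set hi.integrableOn
        (Filter.Eventually.of_forall fun x => (Real.exp_pos _).le)
        (Filter.Eventually.of_forall fun x hx =>
          (abs_le.2 ⟨by linarith [hx.1], by linarith [hx.2]⟩ : |x| ≤ 2))
    have : ∫ x in Set.Icc (-1 : ℝ) 1, (1 / 2 : ℝ) = 1 := by simp; norm_num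
    linarith
  have := Real.exp_neg_one_lt_d9
  nlinarith [Real.exp_pos (-1)]

theorem pi_mul_sqrt_mul_sqrt_le {κ h : ℝ} (hκ : 0 < κ) (hh0 : 0 < h)
    (hh : h ≤ 1 / (10000 * Real.pi ^ 2 * κ)) : Real.pi * (√h * √κ) ≤ 1 / 100 := by
  have hπ := Real.pi_pos
  rw [le_div_iff₀ (by positivity)] at hh
  rw [← Real.sqrt_mul hh0.le]
  refine abs_le_of_sq_le_sq' ?_ (by norm_num) |>.2
  rw [mul_pow, Real.sq_sqrt (by positivity)]
  linarith

/-- Each coordinate of `OmegaHard`. -/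
def omegaCoord {d : ℕ} [NeZero d] (κ h : ℝ) (i : Fin d) : Set ℝ :=
  if i = 0 then {c | |c| ≤ 2} else wells ⌊5 / (Real.pi * √(h * κ))⌋ √h

theorem measurableSet_omegaCoord {d : ℕ} [NeZero d] (κ h : ℝ) (i : Fin d) :
    MeasurableSet (omegaCoord κ h i) := by
  unfold omegaCoord
  split_ifs
  · exact measurableSet_le (by fun_prop) measurable_const
  · exact measurableSet_wells _ _

theorem omegaHard_eq_pi (d : ℕ) [NeZero d] (κ h : ℝ) :
    OmegaHard d κ h = Set.univ.pi (omegaCoord κ h) := by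
  ext x
  simp only [OmegaHard, Set.mem_ofPred_eq, Set.mem_univ_pi, omegaCoord]
  refine ⟨fun hx i => ?_, fun hx => ⟨by simpa using hx 0, fun i hi => ?_⟩⟩
  · split_ifs with hi
    · exact hi ▸ hx.1
    · exact hx.2 i hi
  · simpa [hi, wells] using hx i

theorem continuous_fhard1d {d : ℕ} [NeZero d] (κ h : ℝ) (i : Fin d) :
    Continuous (fhard1d κ h i) := by
  unfold fhard1d
  split_ifs <;> fun_prop

theorem exp_neg_one_mul_integral_fhard1d_le {d : ℕ} [NeZero d] {κ h : ℝ} (hκ : 0 < κ)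
    (hh0 : 0 < h) (hh : h ≤ 1 / (10000 * Real.pi ^ 2 * κ)) (i : Fin d) :
    Integrable (fun x => Real.exp (-fhard1d κ h i x)) ∧
      Real.exp (-1) * ∫ x, Real.exp (-fhard1d κ h i x) ≤
        ∫ x in omegaCoord κ h i, Real.exp (-fhard1d κ h i x) := by
  by_cases hi : i = 0
  · simp only [fhard1d, omegaCoord, hi, if_true]
    exact ⟨by simpa only [neg_mul] using integrable_exp_neg_mul_sq (b := 1 / 2) (by norm_num),
      exp_neg_one_mul_integral_gaussian_le⟩
  have hu := Real.sqrt_pos.2 hκ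
  have hs := Real.sqrt_pos.2 hh0
  have hus := pi_mul_sqrt_mul_sqrt_le hκ hh0 hh
  have hwell := setIntegral_gaussian_wells_ge hu hs hus
  rw [Real.sq_sqrt hκ.le, ← Real.sqrt_mul hh0.le] at hwell
  have hc : κ * h / 3 ≤ 1 / 100 := by
    have h1 : √h * √κ ≤ 1 / 100 := by
      nlinarith [mul_pos hs hu, Real.pi_gt_three]
    have h2 : κ * h = (√h * √κ) ^ 2 := by
      rw [mul_pow, Real.sq_sqrt hh0.le, Real.sq_sqrt hκ.le, mul_comm]
    rw [h2]
    nlinarith [mul_pos hs hu]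
  have key := setIntegral_exp_perturb_ge (f := fun x => -fhard1d κ h i x)
    (g := fun x => -(κ / 3) * x ^ 2) (continuous_fhard1d κ h i).neg
    (integrable_exp_neg_mul_sq (by positivity)) (c := κ * h / 3) (p := 2 / 5) (by norm_num)
    (fun x => by
      simp only [fhard1d, hi, if_false]
      rw [show -(κ / 3 * x ^ 2 - κ * h / 3 * Real.cos (x / √h)) - -(κ / 3) * x ^ 2 =
        κ * h / 3 * Real.cos (x / √h) by ring, abs_mul, abs_of_pos (by positivity)]
      exact mul_le_of_le_one_right (by positivity) (Real.abs_cos_le_one _)) hwell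
  simp only [omegaCoord, hi, if_false]
  refine ⟨key.1, le_trans ?_ key.2⟩
  refine mul_le_mul_of_nonneg_right ?_ (integral_nonneg fun x => (Real.exp_pos _).le)
  have := Real.exp_neg_one_lt_d9
  linarith [Real.add_one_le_exp (-(2 * (κ * h / 3)))]

theorem le_piStar_omegaHard {d : ℕ} [NeZero d] {κ h : ℝ} (hκ : 0 < κ)
    (hh0 : 0 < h) (hh : h ≤ 1 / (10000 * Real.pi ^ 2 * κ)) :
    ENNReal.ofReal (Real.exp (-(d : ℝ))) ≤ piStar d κ h (OmegaHard d κ h) := by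
  have h1 := exp_neg_one_mul_integral_fhard1d_le (d := d) hκ hh0 hh
  have hprod : ∀ x : Fin d → ℝ, Real.exp (-fhard κ h x) = ∏ i, Real.exp (-fhard1d κ h i (x i)) :=
    fun x => by rw [← Real.exp_sum, fhard, Finset.sum_neg_distrib]
  have hint : Integrable fun x : Fin d → ℝ => Real.exp (-fhard κ h x) := by
    simp only [hprod]
    exact Integrable.fintype_prod_dep fun i => (h1 i).1
  have hΩ : MeasurableSet (OmegaHard d κ h) := by
    rw [omegaHard_eq_pi]
    exact MeasurableSet.univ_pi fun i : Fin d => measurableSet_omegaCoord κ h i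
  have hZ : ∫ x : Fin d → ℝ, Real.exp (-fhard κ h x) =
      ∏ i : Fin d, ∫ x, Real.exp (-fhard1d κ h i x) := by
    simp only [hprod]
    exact integral_fintype_prod_volume_eq_prod fun i x => Real.exp (-fhard1d κ h i x)
  have hN : ∫ x in OmegaHard d κ h, Real.exp (-fhard κ h x) =
      ∏ i : Fin d, ∫ x in omegaCoord κ h i, Real.exp (-fhard1d κ h i x) := by
    simp only [hprod]
    rw [omegaHard_eq_pi, volume_pi, Measure.restrict_pi_pi]
    exact integral_fintype_prod_eq_prod fun i x => Real.exp (-fhard1d κ h i x)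
  have hZN : Real.exp (-(d : ℝ)) * ∫ x : Fin d → ℝ, Real.exp (-fhard κ h x) ≤
      ∫ x in OmegaHard d κ h, Real.exp (-fhard κ h x) := by
    have : Real.exp (-(d : ℝ)) = ∏ _i : Fin d, Real.exp (-1) := by
      rw [← Real.exp_sum]; simp
    rw [hZ, hN, this, ← Finset.prod_mul_distrib]
    exact Finset.prod_le_prod (fun i _ => mul_nonneg (Real.exp_pos _).le
      (integral_nonneg fun x => (Real.exp_pos _).le)) fun i _ => (h1 i).2
  have hZ0 : 0 < ∫ x : Fin d → ℝ, Real.exp (-fhard κ h x) := integral_exp_pos hint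
  have hnn : ∀ μ : Measure (Fin d → ℝ), 0 ≤ᵐ[μ] fun x => Real.exp (-fhard κ h x) :=
    fun μ => Filter.Eventually.of_forall fun x => (Real.exp_pos _).le
  rw [piStar, Measure.smul_apply, withDensity_apply _ MeasurableSet.univ, withDensity_apply _ hΩ,
    Measure.restrict_univ, ← ofReal_integral_eq_lintegral_ofReal hint (hnn _),
    ← ofReal_integral_eq_lintegral_ofReal hint.integrableOn (hnn _), smul_eq_mul,
    ← ENNReal.ofReal_inv_of_pos hZ0, ← ENNReal.ofReal_mul (inv_nonneg.2 hZ0.le)]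
  refine ENNReal.ofReal_le_ofReal ?_
  rwa [inv_mul_eq_div, le_div_iff₀ hZ0]

theorem abs_le_of_mem_wells {u s c : ℝ} (hu : 0 < u) (hs : 0 < s)
    (hc : c ∈ wells ⌊5 / (Real.pi * (s * u))⌋ s) :
    |c| ≤ 10 / u + (9 / 20) * Real.pi * s := by
  obtain ⟨k, hk, h1, h2⟩ := hc
  have hπ := Real.pi_pos
  have hk' : |(k : ℝ)| ≤ 5 / (Real.pi * (s * u)) := by
    have := (Int.cast_le (R := ℝ)).2 hk
    rw [Int.cast_abs] at this
    exact this.trans (Int.floor_le _)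
  have hbound : |2 * Real.pi * k * s| ≤ 10 / u := by
    rw [show 2 * Real.pi * k * s = (2 * Real.pi * s) * k by ring, abs_mul,
      abs_of_pos (by positivity)]
    calc 2 * Real.pi * s * |(k : ℝ)| ≤ 2 * Real.pi * s * (5 / (Real.pi * (s * u))) := by gcongr
      _ = 10 / u := by field_simp; norm_num
  have := abs_le.1 hbound
  exact abs_le.2 ⟨by linarith, by linarith⟩

theorem abs_deriv_fhard1d_le {d : ℕ} [NeZero d] {κ h : ℝ} (hκ : 10 ≤ κ)
    (hh0 : 0 < h) (hh : h ≤ 1 / (10000 * Real.pi ^ 2 * κ)) (i : Fin d) {c : ℝ}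
    (hc : c ∈ omegaCoord κ h i) : |deriv (fhard1d κ h i) c| ≤ 10 * √κ := by
  have hκ0 : 0 < κ := by linarith
  have hu1 : 1 ≤ √κ := Real.one_le_sqrt.2 (by linarith)
  by_cases hi : i = 0
  · simp only [omegaCoord, hi, if_true, Set.mem_ofPred_eq] at hc
    have : deriv (fhard1d κ h i) c = c := by
      have h1 : HasDerivAt (fhard1d κ h i) ((1 / 2) * (2 * c)) c := by
        have hf : fhard1d κ h i = fun c => (1 / 2) * c ^ 2 := by ext; simp [fhard1d, hi]
        rw [hf]
        simpa using (hasDerivAt_pow 2 c).const_mul (1 / 2 : ℝ)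
      rw [h1.deriv]; ring
    rw [this]
    linarith
  simp only [omegaCoord, hi, if_false] at hc
  have hs := Real.sqrt_pos.2 hh0
  have hus := pi_mul_sqrt_mul_sqrt_le hκ0 hh0 hh
  rw [Real.sqrt_mul hh0.le] at hc
  have hu : 0 < √κ := by linarith
  have hcabs := abs_le_of_mem_wells hu hs hc
  have hderiv : deriv (fhard1d κ h i) c =
      2 * κ / 3 * c + κ * √h / 3 * Real.sin (c / √h) := by
    have h1 : HasDerivAt (fhard1d κ h i)
        (κ / 3 * (2 * c) - κ * h / 3 * (-Real.sin (c / √h) * (1 / √h))) c := by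
      have hp := (hasDerivAt_pow 2 c).const_mul (κ / 3)
      have hq := ((hasDerivAt_id c).div_const √h).cos.const_mul (κ * h / 3)
      have hf : fhard1d κ h i =
          fun c => (κ / 3) * c ^ 2 - (κ * h / 3) * Real.cos (c / √h) := by
        ext; simp [fhard1d, hi]
      rw [hf]
      simpa using hp.fun_sub hq
    rw [h1.deriv]
    have : h * (1 / √h) = √h := by rw [mul_one_div, Real.div_sqrt]
    linear_combination κ / 3 * Real.sin (c / √h) * this
  have hsin : |κ * √h / 3 * Real.sin (c / √h)| ≤ κ * √h / 3 := by
    rw [abs_mul, abs_of_pos (by positivity)]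
    exact mul_le_of_le_one_right (by positivity) (Real.abs_sin_le_one _)
  have hlin : |2 * κ / 3 * c| ≤ 2 * κ / 3 * (10 / √κ + (9 / 20) * Real.pi * √h) := by
    rw [abs_mul, abs_of_pos (by positivity)]
    gcongr
  have hκu : κ = √κ * √κ := (Real.mul_self_sqrt hκ0.le).symm
  have e1 : 2 * κ / 3 * (10 / √κ + (9 / 20) * Real.pi * √h) =
      20 / 3 * √κ + 3 / 10 * (Real.pi * (√h * √κ)) * √κ := by
    have : κ / √κ = √κ := Real.div_sqrt
    calc _ = 20 / 3 * (κ / √κ) + 3 / 10 * (Real.pi * √h) * κ := by ring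
      _ = 20 / 3 * √κ + 3 / 10 * (Real.pi * √h) * (√κ * √κ) := by rw [this, ← hκu]
      _ = _ := by ring
  have e2 : κ * √h / 3 = (√h * √κ) / 3 * √κ := by
    calc κ * √h / 3 = (√κ * √κ) * √h / 3 := by rw [← hκu]
      _ = _ := by ring
  have hsu : √h * √κ ≤ 1 / 100 := by nlinarith [mul_pos hs hu, Real.pi_gt_three]
  rw [hderiv]
  refine (abs_add_le _ _).trans ?_
  rw [e1] at hlin
  rw [e2] at hsin
  rw [e2]
  nlinarith

theorem omega_hard_measure_and_gradient (d : ℕ) [NeZero d] (κ h : ℝ) (hκ : 10 ≤ κ)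
    (hh0 : 0 < h) (hh : h ≤ 1 / (10000 * Real.pi ^ 2 * κ)) :
    ENNReal.ofReal (Real.exp (-(d : ℝ))) ≤ piStar d κ h (OmegaHard d κ h) ∧
      ∀ x ∈ OmegaHard d κ h,
        Real.sqrt (∑ i, (deriv (fhard1d κ h i) (x i)) ^ 2) ≤
          10 * Real.sqrt (κ * d) := by
  refine ⟨le_piStar_omegaHard (by linarith) hh0 hh, fun x hx => ?_⟩
  rw [omegaHard_eq_pi, Set.mem_univ_pi] at hx
  refine Real.sqrt_le_iff.2 ⟨by positivity, ?_⟩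
  calc ∑ i, (deriv (fhard1d κ h i) (x i)) ^ 2 ≤ ∑ _i : Fin d, 100 * κ := by
        refine Finset.sum_le_sum fun i _ => ?_
        have h1 := pow_le_pow_left₀ (abs_nonneg _) (abs_deriv_fhard1d_le hκ hh0 hh i (hx i)) 2
        rw [sq_abs, mul_pow, Real.sq_sqrt (by linarith)] at h1
        linarith
    _ = (10 * Real.sqrt (κ * d)) ^ 2 := by
        rw [mul_pow, Real.sq_sqrt (by positivity), Finset.sum_const, Finset.card_univ,
          Fintype.card_fin, nsmul_eq_mul]
        ring
end
end
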